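/- arXiv:2306.11281 — 2 statements merged into one kernel-verified Lean document; each statement's English description precedes it below -/
import Mathlib

section
/- Fix a latent dimension m, a number of domains N, a probability mass function p on {1,…,N}, and probability measures μ_d on ℝ^n for each domain d. Then the counterfactual pseudo-metric d_C is a pseudo-metric on ILDs with observation space ℝ^n whose component maps are Borel measurable bijections with measurable inverses: for all such ILDs M₁, M₂, M₃, one has d_C(M₁,M₁) = 0, d_C(M₁,M₂) = d_C(M₂,M₁), and d_C(M₁,M₃) ≤ d_C(M₁,M₂) + d_C(M₂,M₃). -/
open MeasureTheory ProbabilityTheory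
open scoped ENNReal

/-- A map `f : ℝ^m → ℝ^m` is autoregressive if each output coordinate depends only on the
input coordinates with index at most its own. -/
def Autoregressive (m : ℕ)
    (f : EuclideanSpace ℝ (Fin m) → EuclideanSpace ℝ (Fin m)) : Prop :=
  ∀ (j : Fin m) (x y : EuclideanSpace ℝ (Fin m)), (∀ i, i ≤ j → x i = y i) → f x j = f y j

/-- An invertible latent domain causal model (ILD) with latent dimension `m`, `N` domains,
and observation space `ℝ^n` (with Euclidean norm). -/
structure ILD (m N n : ℕ) where
  g : EuclideanSpace ℝ (Fin m) ≃ EuclideanSpace ℝ (Fin n)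
  f : Fin N → EuclideanSpace ℝ (Fin m) ≃ EuclideanSpace ℝ (Fin m)
  hauto : ∀ d, Autoregressive m (f d)

/-- All component maps of the ILD are Borel measurable bijections with measurable
inverses. -/
def MeasILD {m N n : ℕ} (M : ILD m N n) : Prop :=
  Measurable ⇑M.g ∧ Measurable ⇑M.g.symm ∧
    (∀ d, Measurable ⇑(M.f d)) ∧ ∀ d, Measurable ⇑(M.f d).symm

/-- The standard Gaussian measure on `ℝ^m`: the `m`-fold product of `N(0,1)`. -/
noncomputable def stdGaussian (m : ℕ) : Measure (EuclideanSpace ℝ (Fin m)) :=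
  (Measure.pi fun _ : Fin m => gaussianReal 0 1).map (WithLp.toLp 2)

/-- The counterfactual pseudo-metric between two ILDs, relative to domain weights `p`
and domain distributions `μ_d`: the square root of the expected squared distance between
the domain counterfactuals of the two models. -/
noncomputable def dC {m N n : ℕ} (p : Fin N → ℝ≥0∞)
    (μ : Fin N → Measure (EuclideanSpace ℝ (Fin n)))
    (M M' : ILD m N n) : ℝ≥0∞ :=
  (∑ d : Fin N, ∑ d' : Fin N, p d * p d' *
    ∫⁻ x, (‖M.g (M.f d' ((M.f d).symm (M.g.symm x))) -
      M'.g (M'.f d' ((M'.f d).symm (M'.g.symm x)))‖₊ : ℝ≥0∞) ^ 2 ∂(μ d)) ^ (1/2 : ℝ)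

/-- Minkowski's inequality for a finite weighted family of `L²` seminorms. -/
theorem weighted_L2_add_le {ι α : Type*} [MeasurableSpace α] (s : Finset ι) (w : ι → ℝ≥0∞)
    (ν : ι → Measure α) (F G : ι → α → ℝ≥0∞)
    (hF : ∀ i, Measurable (F i)) (hG : ∀ i, Measurable (G i)) :
    (∑ i ∈ s, w i * ∫⁻ x, (F i x + G i x) ^ 2 ∂(ν i)) ^ (1/2 : ℝ) ≤
      (∑ i ∈ s, w i * ∫⁻ x, F i x ^ 2 ∂(ν i)) ^ (1/2 : ℝ) +
        (∑ i ∈ s, w i * ∫⁻ x, G i x ^ 2 ∂(ν i)) ^ (1/2 : ℝ) := by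
  have sqrt_sq (a : ℝ≥0∞) : (a ^ (1/2 : ℝ)) ^ (2 : ℝ) = a := by
    rw [← ENNReal.rpow_mul]; norm_num
  have weighted_sqrt (i : ι) (H : α → ℝ≥0∞) :
      w i * ∫⁻ x, H x ^ 2 ∂(ν i) =
        (w i ^ (1/2 : ℝ) * (∫⁻ x, H x ^ (2 : ℝ) ∂(ν i)) ^ (1/2 : ℝ)) ^ (2 : ℝ) := by
    rw [ENNReal.mul_rpow_of_nonneg _ _ (by norm_num), sqrt_sq, sqrt_sq]
    simp only [ENNReal.rpow_two]
  simp only [weighted_sqrt _ (F _), weighted_sqrt _ (G _),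
    weighted_sqrt _ (fun x => F _ x + G _ x)]
  refine le_trans ?_ (ENNReal.Lp_add_le s _ _ (by norm_num))
  gcongr with i _
  rw [← mul_add]
  gcongr
  exact ENNReal.lintegral_Lp_add_le (hF i).aemeasurable (hG i).aemeasurable (by norm_num)

/-- The counterfactual map from domain `d` to domain `d'` of a measurable ILD is measurable. -/
theorem MeasILD.measurable_counterfactual {m N n : ℕ} {M : ILD m N n} (hM : MeasILD M)
    (d d' : Fin N) :
    Measurable fun x => M.g (M.f d' ((M.f d).symm (M.g.symm x))) :=
  hM.1.comp ((hM.2.2.1 d').comp ((hM.2.2.2 d).comp hM.2.1))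

/-- The counterfactual pseudo-metric is a pseudo-metric on ILDs with measurable
components: it vanishes on the diagonal, is symmetric, and satisfies the triangle
inequality. -/
theorem stmt13 (m N n : ℕ) (p : Fin N → ℝ≥0∞) (hp : ∑ d, p d = 1)
    (μ : Fin N → Measure (EuclideanSpace ℝ (Fin n)))
    (hμ : ∀ d, IsProbabilityMeasure (μ d))
    (M₁ M₂ M₃ : ILD m N n)
    (hM₁ : MeasILD M₁) (hM₂ : MeasILD M₂) (hM₃ : MeasILD M₃) :
    dC p μ M₁ M₁ = 0 ∧ dC p μ M₁ M₂ = dC p μ M₂ M₁ ∧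
      dC p μ M₁ M₃ ≤ dC p μ M₁ M₂ + dC p μ M₂ M₃ := by
  refine ⟨by simp [dC], ?_, ?_⟩
  · simp only [dC]
    congr! 8 with d _ d' _ x
    rw [← nnnorm_neg, neg_sub]
  · simp only [dC, ← Finset.sum_product']
    refine le_trans ?_ (weighted_L2_add_le _ (fun i : Fin N × Fin N => p i.1 * p i.2)
      (fun i => μ i.1) _ _
      (fun i => ((hM₁.measurable_counterfactual i.1 i.2).sub
        (hM₂.measurable_counterfactual i.1 i.2)).nnnorm.coe_nnreal_ennreal)
      (fun i => ((hM₂.measurable_counterfactual i.1 i.2).sub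
        (hM₃.measurable_counterfactual i.1 i.2)).nnnorm.coe_nnreal_ennreal))
    gcongr with i _ x
    rw [← ENNReal.coe_add, ENNReal.coe_le_coe]
    simpa using nnnorm_add_le
      (M₁.g (M₁.f i.2 ((M₁.f i.1).symm (M₁.g.symm x))) -
        M₂.g (M₂.f i.2 ((M₂.f i.1).symm (M₂.g.symm x))))
      (M₂.g (M₂.f i.2 ((M₂.f i.1).symm (M₂.g.symm x))) -
        M₃.g (M₃.f i.2 ((M₃.f i.1).symm (M₃.g.symm x))))
end

section
/- Fix a latent dimension m, N domains, and a probability mass function p on {1,…,N}. Let (g̃,(f̃_d)) and (g*,(f*_d)) be two ILDs with observation space ℝ^n, all component maps Borel measurable bijections with measurable inverses, which are distributionally equivalent: for every domain d, the pushforward of γ under g̃ ∘ f̃_d equals the pushforward μ_d of γ under g* ∘ f*_d. Let d_C be the counterfactual pseudo-metric associated with p and (μ_d). Then d_C((g̃,F̃),(g*,F*))² ≤ 2 Σ_{d,d'} p(d) p(d') ∫ ‖ g̃(f̃_{d'}(ε)) − g̃(f̃_d(ε)) ‖² dγ(ε) + 2 Σ_{d,d'} p(d) p(d') ∫ ‖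 g*(f*_{d'}(ε)) − g*(f*_d(ε)) ‖² dγ(ε). -/
open MeasureTheory ProbabilityTheory
open scoped ENNReal

/-- The relaxed parallelogram bound for extended norms. -/
theorem nnnorm_sub_sq_le_two_mul_add {E : Type*} [SeminormedAddCommGroup E] (a b c : E) :
    (‖a - b‖₊ : ℝ≥0∞) ^ 2 ≤ 2 * (‖a - c‖₊ : ℝ≥0∞) ^ 2 + 2 * (‖b - c‖₊ : ℝ≥0∞) ^ 2 := by
  have h : ‖a - b‖₊ ^ 2 ≤ 2 * ‖a - c‖₊ ^ 2 + 2 * ‖b - c‖₊ ^ 2 := by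
    rw [← NNReal.coe_le_coe]
    push_cast
    have htri : ‖a - b‖ ≤ ‖a - c‖ + ‖b - c‖ := by
      simpa using norm_sub_le (a - c) (b - c)
    nlinarith [norm_nonneg (a - b), sq_nonneg (‖a - c‖ - ‖b - c‖)]
  exact_mod_cast h

/-- The squared displacement of a counterfactual map is measurable. -/
theorem MeasILD.measurable_counterfactual_sub_id {m N n : ℕ} {M : ILD m N n} (hM : MeasILD M)
    (d d' : Fin N) :
    Measurable fun x =>
      (‖M.g (M.f d' ((M.f d).symm (M.g.symm x))) - x‖₊ : ℝ≥0∞) ^ 2 := by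
  obtain ⟨hg, hg', hf, hf'⟩ := hM
  exact ((hg.comp ((hf d').comp ((hf' d).comp hg'))).sub
    measurable_id).nnnorm.coe_nnreal_ennreal.pow_const 2

/-- The mean squared displacement of a counterfactual map under a domain distribution,
expressed through the exogenous noise. -/
theorem MeasILD.lintegral_counterfactual_sub_id {m N n : ℕ} {M : ILD m N n} (hM : MeasILD M)
    (ν : Measure (EuclideanSpace ℝ (Fin m))) (d d' : Fin N) :
    ∫⁻ x, (‖M.g (M.f d' ((M.f d).symm (M.g.symm x))) - x‖₊ : ℝ≥0∞) ^ 2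
        ∂(ν.map (⇑M.g ∘ ⇑(M.f d))) =
      ∫⁻ ε, (‖M.g (M.f d' ε) - M.g (M.f d ε)‖₊ : ℝ≥0∞) ^ 2 ∂ν := by
  rw [lintegral_map (hM.measurable_counterfactual_sub_id d d') (hM.1.comp (hM.2.2.1 d))]
  simp

/-- For two distributionally equivalent ILDs, the squared counterfactual pseudo-metric is
bounded by twice the sum of the expected squared cross-domain differences of each model. -/
theorem stmt15 (m N n : ℕ) (p : Fin N → ℝ≥0∞) (hp : ∑ d, p d = 1)
    (Mt Ms : ILD m N n) (hMt : MeasILD Mt) (hMs : MeasILD Ms)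
    (μ : Fin N → Measure (EuclideanSpace ℝ (Fin n)))
    (hμ : ∀ d, μ d = (stdGaussian m).map (⇑Ms.g ∘ ⇑(Ms.f d)))
    (hdist : ∀ d, (stdGaussian m).map (⇑Mt.g ∘ ⇑(Mt.f d)) = μ d) :
    dC p μ Mt Ms ^ 2 ≤
      2 * ∑ d : Fin N, ∑ d' : Fin N, p d * p d' *
        ∫⁻ ε, (‖Mt.g (Mt.f d' ε) - Mt.g (Mt.f d ε)‖₊ : ℝ≥0∞) ^ 2 ∂(stdGaussian m) +
      2 * ∑ d : Fin N, ∑ d' : Fin N, p d * p d' *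
        ∫⁻ ε, (‖Ms.g (Ms.f d' ε) - Ms.g (Ms.f d ε)‖₊ : ℝ≥0∞) ^ 2 ∂(stdGaussian m) := by
  have hsq : ∀ t : ℝ≥0∞, (t ^ (1 / 2 : ℝ)) ^ 2 = t := fun t => by
    rw [← ENNReal.rpow_natCast, ← ENNReal.rpow_mul]
    norm_num
  rw [dC, hsq]
  simp only [Finset.mul_sum, ← Finset.sum_add_distrib]
  refine Finset.sum_le_sum fun d _ => Finset.sum_le_sum fun d' _ => ?_
  rw [← hMt.lintegral_counterfactual_sub_id, ← hMs.lintegral_counterfactual_sub_id, hdist, ← hμ,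
    mul_left_comm 2, mul_left_comm 2, ← mul_add]
  gcongr
  rw [← lintegral_const_mul' _ _ ENNReal.ofNat_ne_top,
    ← lintegral_const_mul' _ _ ENNReal.ofNat_ne_top,
    ← lintegral_add_left ((hMt.measurable_counterfactual_sub_id d d').const_mul 2)]
  exact lintegral_mono fun x => nnnorm_sub_sq_le_two_mul_add _ _ x
end
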